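/- Let r ≥ 2, c ≥ 5, q ≥ 0, and let G_{r,c} be a balanced c-partite tournament with δ(G_{r,c}) ≥ q(r + μ(G_{r,c}))·(c−1)/(c−2) and i_g(G_{r,c}) = r(c−1)β for some 0 ≤ β < (c−2q−2)/c. Then for every vertex x, T⁺_q(x) ≤ C(c−1, q+1)·(r/2)^{c−1}·(1+β)^{c−2−2q}·(q+1)/(c(1−β)−2q−2). -/

import Mathlib

open Finset

/-- A balanced `c`-partite tournament with parts `Vᵢ = {i} × Fin r`: an orientation of the
complete `c`-partite graph in which every part has exactly `r` vertices. -/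
structure BalancedMPT (c r : ℕ) where
  adj : Fin c × Fin r → Fin c × Fin r → Bool
  oriented : ∀ u v, u.1 ≠ v.1 → adj u v = !adj v u
  samePart : ∀ u v, u.1 = v.1 → adj u v = false

namespace BalancedMPT

variable {c r : ℕ}

/-- Out-degree of a vertex. -/
def outDeg (G : BalancedMPT c r) (x : Fin c × Fin r) : ℕ :=
  (univ.filter fun y => G.adj x y = true).card

/-- In-degree of a vertex. -/
def inDeg (G : BalancedMPT c r) (x : Fin c × Fin r) : ℕ :=
  (univ.filter fun y => G.adj y x = true).card

/-- `d⁺ᵢ(x)`: number of out-neighbours of `x` in the part `Vᵢ`. -/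
def outDegIn (G : BalancedMPT c r) (x : Fin c × Fin r) (i : Fin c) : ℕ :=
  (univ.filter fun v : Fin r => G.adj x (i, v) = true).card

/-- `d⁻ᵢ(x)`: number of in-neighbours of `x` in the part `Vᵢ`. -/
def inDegIn (G : BalancedMPT c r) (x : Fin c × Fin r) (i : Fin c) : ℕ :=
  (univ.filter fun v : Fin r => G.adj (i, v) x = true).card

end BalancedMPT

open BalancedMPT

open Polynomial in
noncomputable def lin (b : ℝ) : ℝ[X] := C (1 - b) + C b * X

open Polynomial in
noncomputable def gen {ι : Type} (s : Finset ι) (p : ι → ℝ) : ℝ[X] := ∏ i ∈ s, lin (p i)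

open Polynomial in
noncomputable def cum (R : ℝ[X]) (q : ℕ) : ℝ := ∑ k ∈ range (q + 1), R.coeff k

open Polynomial in
lemma lin_coeff (b : ℝ) (R : ℝ[X]) (q : ℕ) :
    (lin b * R).coeff q = (1 - b) * R.coeff q + b * (X * R).coeff q := by
  rw [lin, add_mul, coeff_add, coeff_C_mul, mul_assoc, coeff_C_mul]

open Polynomial in
lemma lin_cum (b : ℝ) (R : ℝ[X]) (q : ℕ) :
    cum (lin b * R) q = cum R q - b * R.coeff q := by
  unfold cum
  induction q with
  | zero => simp [lin_coeff]; ring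
  | succ q ih => rw [sum_range_succ, ih, sum_range_succ _ (q + 1), lin_coeff, coeff_X_mul]; ring

open Polynomial in
lemma lin2_cum (a b : ℝ) (R : ℝ[X]) (q : ℕ) :
    cum (lin a * (lin b * R)) q = cum R q - (a + b) * R.coeff q
      + a * b * (R.coeff q - (X * R).coeff q) := by
  rw [lin_cum, lin_cum, lin_coeff]; ring

open Polynomial in
lemma gen_nonneg {ι : Type} [DecidableEq ι] (s : Finset ι) (p : ι → ℝ)
    (h0 : ∀ i ∈ s, 0 ≤ p i) (h1 : ∀ i ∈ s, p i ≤ 1) (k : ℕ) : 0 ≤ (gen s p).coeff k := by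
  induction s using Finset.induction_on generalizing k with
  | empty => simp only [gen, prod_empty, coeff_one]; split_ifs <;> norm_num
  | insert a s ha ih =>
    have ih := ih (fun i hi => h0 i (mem_insert_of_mem hi)) (fun i hi => h1 i (mem_insert_of_mem hi))
    have h0 := h0 a (mem_insert_self _ _)
    have h1 := h1 a (mem_insert_self _ _)
    have e : gen (insert a s) p = lin (p a) * gen s p := by rw [gen, prod_insert ha, gen]
    rw [e, lin_coeff]
    have : 0 ≤ (X * gen s p).coeff k := by
      cases k with
      | zero => simp
      | succ k => rw [coeff_X_mul]; exact ih k
    have := ih k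
    have : 0 ≤ 1 - p a := by linarith
    positivity

open Polynomial in
lemma gen_erase {ι : Type} [DecidableEq ι] (s : Finset ι) (p : ι → ℝ) (k : ι) (hk : k ∈ s) :
    gen s p = lin (p k) * gen (s.erase k) p := by
  rw [gen, gen, mul_prod_erase s (fun i => lin (p i)) hk]

open Polynomial in
lemma gen_deriv {ι : Type} [DecidableEq ι] (s : Finset ι) (p : ι → ℝ) :
    derivative (gen s p) = ∑ k ∈ s, C (p k) * gen (s.erase k) p := by
  rw [gen, derivative_prod_finset]
  refine sum_congr rfl fun k _ => ?_
  rw [gen, mul_comm]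
  simp [lin]

open Polynomial in
lemma key {ι : Type} [DecidableEq ι] (t : Finset ι) (p : ι → ℝ) (m : ℝ) (q : ℕ) (hm : 0 < m)
    (h0 : ∀ i ∈ t, 0 ≤ p i) (h1 : ∀ i ∈ t, p i ≤ 1) (h2 : ∀ i ∈ t, p i ≤ m)
    (h3 : ∀ i ∈ t, 1 - p i ≤ m) (hs : (2 * q + 1) * m ≤ ∑ i ∈ t, p i) :
    (gen t p).coeff q ≤ (gen t p).coeff (q + 1) := by
  have e1 : ((q : ℝ) + 1) * (gen t p).coeff (q + 1)
      = ∑ k ∈ t, p k * (gen (t.erase k) p).coeff q := by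
    have := congrArg (fun P => P.coeff q) (gen_deriv t p)
    simp only [coeff_derivative, finsetSum_coeff, coeff_C_mul] at this
    rw [← this]; ring
  have e2 : (q : ℝ) * (gen t p).coeff q
      = ∑ k ∈ t, p k * (X * gen (t.erase k) p).coeff q := by
    cases q with
    | zero => simp
    | succ q =>
      have := congrArg (fun P => P.coeff q) (gen_deriv t p)
      simp only [coeff_derivative, finsetSum_coeff, coeff_C_mul] at this
      simp only [coeff_X_mul]
      rw [← this]; push_cast; ring
  have hR : 0 ≤ (gen t p).coeff q := gen_nonneg t p h0 h1 q
  have e3 : ∑ k ∈ t, (p k * (gen t p).coeff q - m * (p k * (X * gen (t.erase k) p).coeff q))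
      ≤ ∑ k ∈ t, m * (p k * (gen (t.erase k) p).coeff q) := by
    refine sum_le_sum fun k hk => ?_
    rw [gen_erase t p k hk, lin_coeff]
    have hn : ∀ j, 0 ≤ (gen (t.erase k) p).coeff j :=
      gen_nonneg _ p (fun i hi => h0 i (mem_of_mem_erase hi)) (fun i hi => h1 i (mem_of_mem_erase hi))
    have hA := hn q
    have hB : 0 ≤ (X * gen (t.erase k) p).coeff q := by
      cases q with
      | zero => simp
      | succ q => rw [coeff_X_mul]; exact hn q
    set A := (gen (t.erase k) p).coeff q
    set B := (X * gen (t.erase k) p).coeff q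
    have := h0 k hk
    have a1 : 0 ≤ p k * A * (m - (1 - p k)) := mul_nonneg (mul_nonneg this hA) (by linarith [h3 k hk])
    have a2 : 0 ≤ p k * B * (m - p k) := mul_nonneg (mul_nonneg this hB) (by linarith [h2 k hk])
    nlinarith
  rw [sum_sub_distrib, ← mul_sum, ← mul_sum, ← sum_mul, ← e1, ← e2] at e3
  have e4 := mul_le_mul_of_nonneg_right hs hR
  have : 0 < m * (q + 1) := by positivity
  refine le_of_mul_le_mul_left ?_ this
  nlinarith

open Polynomial in
lemma smooth_step {ι : Type} [DecidableEq ι] (s : Finset ι) (p p' : ι → ℝ) (i j : ι)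
    (hi : i ∈ s) (hj : j ∈ s) (hij : i ≠ j) (hp : ∀ k, k ≠ i → k ≠ j → p' k = p k)
    (hsum : p' i + p' j = p i + p j) (hprod : p i * p j ≤ p' i * p' j) (q : ℕ)
    (hR : (X * gen ((s.erase i).erase j) p).coeff q ≤ (gen ((s.erase i).erase j) p).coeff q) :
    cum (gen s p) q ≤ cum (gen s p') q := by
  have hj' : j ∈ s.erase i := mem_erase.2 ⟨hij.symm, hj⟩
  have e : gen ((s.erase i).erase j) p' = gen ((s.erase i).erase j) p := by
    refine prod_congr rfl fun k hk => ?_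
    simp only [mem_erase] at hk
    rw [hp k hk.2.1 hk.1]
  rw [gen_erase s p i hi, gen_erase _ p j hj', gen_erase s p' i hi, gen_erase _ p' j hj', e,
    lin2_cum, lin2_cum, hsum]
  have := mul_le_mul_of_nonneg_right hprod (sub_nonneg.2 hR)
  linarith

open Polynomial in
lemma smoothing {ι : Type} [DecidableEq ι] (s : Finset ι) (m p0 : ℝ) (q : ℕ) (hm : 0 < m)
    (hp0 : 0 ≤ p0) (hp1 : p0 ≤ 1) (hp2 : p0 ≤ m) (hp3 : 1 - p0 ≤ m)
    (hq : 2 * q * m ≤ (#s - 1) * p0) (N : ℕ) (p : ι → ℝ)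
    (hN : #{i ∈ s | p i ≠ p0} ≤ N)
    (h0 : ∀ i ∈ s, 0 ≤ p i) (h1 : ∀ i ∈ s, p i ≤ 1) (h2 : ∀ i ∈ s, p i ≤ m)
    (h3 : ∀ i ∈ s, 1 - p i ≤ m) (hs : #s * p0 ≤ ∑ i ∈ s, p i) :
    cum (gen s p) q ≤ cum (gen s fun _ => p0) q := by
  induction N generalizing p with
  | zero =>
    refine le_of_eq (congrArg (fun P => cum P q) (prod_congr rfl fun k hk => ?_))
    have := filter_eq_empty_iff.1 (card_eq_zero.1 (Nat.le_zero.1 hN)) hk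
    rw [not_not.1 this]
  | succ N ih =>
    by_cases hlt : ∃ j ∈ s, p j < p0
    · obtain ⟨j, hj, hjlt⟩ := hlt
      obtain ⟨i, hi, hilt⟩ : ∃ i ∈ s, p0 < p i := by
        by_contra! h
        have : ∑ i ∈ s, p i < ∑ i ∈ s, p0 := sum_lt_sum h ⟨j, hj, hjlt⟩
        simp at this
        linarith
      have hij : i ≠ j := by rintro rfl; linarith
      have hj' : j ∈ s.erase i := mem_erase.2 ⟨hij.symm, hj⟩
      have main : ∀ u v : ℝ, u + v = p i + p j → (u = p0 ∨ v = p0) → p j ≤ u → u ≤ p i →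
          p j ≤ v → v ≤ p i → cum (gen s p) q ≤ cum (gen s fun _ => p0) q := by
        intro u v huv huv0 hu1 hu2 hv1 hv2
        have hji := hij.symm
        let p' : ι → ℝ := fun k => if k = i then u else if k = j then v else p k
        have pi' : p' i = u := by simp [p']
        have pj' : p' j = v := by simp [p', hji]
        have pk' : ∀ k, k ≠ i → k ≠ j → p' k = p k := by
          intro k hk1 hk2; simp [p', hk1, hk2]
        have dich : ∀ (Q : ℝ → Prop), Q u → Q v → (∀ k ∈ s, Q (p k)) → ∀ k ∈ s, Q (p' k) := by
          intro Q hu hv hQ k hk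
          by_cases hki : k = i
          · rw [hki, pi']; exact hu
          by_cases hkj : k = j
          · rw [hkj, pj']; exact hv
          rw [pk' k hki hkj]; exact hQ k hk
        have step : cum (gen s p) q ≤ cum (gen s p') q := by
          refine smooth_step s p p' i j hi hj hij pk' (by rw [pi', pj', huv]) ?_ q ?_
          · rw [pi', pj']
            nlinarith [mul_nonneg (sub_nonneg.2 hu1) (sub_nonneg.2 hu2)]
          · have hsub : ∀ k ∈ (s.erase i).erase j, k ∈ s := fun k hk =>
              mem_of_mem_erase (mem_of_mem_erase hk)
            cases q with
            | zero =>
              simpa using gen_nonneg _ p (fun k hk => h0 k (hsub k hk))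
                (fun k hk => h1 k (hsub k hk)) 0
            | succ q =>
              rw [coeff_X_mul]
              refine key _ p m q hm (fun k hk => h0 k (hsub k hk)) (fun k hk => h1 k (hsub k hk))
                (fun k hk => h2 k (hsub k hk)) (fun k hk => h3 k (hsub k hk)) ?_
              have a1 := add_sum_erase s p hi
              have a2 := add_sum_erase _ p hj'
              have := h2 i hi
              push_cast at hq
              nlinarith
        refine step.trans (ih p' ?_ ?_ ?_ ?_ ?_ ?_)
        · have : #{k ∈ s | p' k ≠ p0} < #{k ∈ s | p k ≠ p0} := by
            apply card_lt_card
            rw [ssubset_iff_of_subset]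
            · rcases huv0 with h | h
              · exact ⟨i, by simp [hi, hilt.ne'], by simp [pi', h]⟩
              · exact ⟨j, by simp [hj, hjlt.ne], by simp [pj', h]⟩
            · intro k
              simp only [mem_filter]
              rintro ⟨hk, hk'⟩
              refine ⟨hk, ?_⟩
              by_cases hki : k = i
              · rw [hki]; exact hilt.ne'
              by_cases hkj : k = j
              · rw [hkj]; exact hjlt.ne
              rwa [pk' k hki hkj] at hk'
          omega
        · exact dich (fun y => 0 ≤ y) (by linarith [h0 j hj]) (by linarith [h0 j hj]) h0
        · exact dich (fun y => y ≤ 1) (by linarith [h1 i hi]) (by linarith [h1 i hi]) h1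
        · exact dich (fun y => y ≤ m) (by linarith [h2 i hi]) (by linarith [h2 i hi]) h2
        · exact dich (fun y => 1 - y ≤ m) (by linarith [h3 j hj]) (by linarith [h3 j hj]) h3
        · have a1 := add_sum_erase s p hi
          have a2 := add_sum_erase _ p hj'
          have a3 := add_sum_erase s p' hi
          have a4 := add_sum_erase _ p' hj'
          have a5 : ∑ k ∈ (s.erase i).erase j, p' k = ∑ k ∈ (s.erase i).erase j, p k := by
            refine sum_congr rfl fun k hk => ?_
            simp only [mem_erase] at hk
            exact pk' k hk.2.1 hk.1
          rw [pi'] at a3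
          rw [pj'] at a4
          linarith
      rcases le_total (p0 - p j) (p i - p0) with h | h
      · exact main (p i + p j - p0) p0 (by ring) (Or.inr rfl) (by linarith) (by linarith)
          (by linarith) (by linarith)
      · exact main p0 (p i + p j - p0) (by ring) (Or.inl rfl) (by linarith) (by linarith)
          (by linarith) (by linarith)
    · push Not at hlt
      by_cases hgt : ∃ i ∈ s, p0 < p i
      · obtain ⟨i, hi, hilt⟩ := hgt
        let p' : ι → ℝ := fun k => if k = i then p0 else p k
        have pi' : p' i = p0 := by simp [p']
        have pk' : ∀ k, k ≠ i → p' k = p k := by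
          intro k hk1; simp [p', hk1]
        have dich : ∀ (Q : ℝ → Prop), Q p0 → (∀ k ∈ s, Q (p k)) → ∀ k ∈ s, Q (p' k) := by
          intro Q hu hQ k hk
          by_cases hki : k = i
          · rw [hki, pi']; exact hu
          rw [pk' k hki]; exact hQ k hk
        have step : cum (gen s p) q ≤ cum (gen s p') q := by
          have e : gen (s.erase i) p' = gen (s.erase i) p := by
            refine prod_congr rfl fun k hk => ?_
            simp only [mem_erase] at hk
            rw [pk' k hk.1]
          rw [gen_erase s p i hi, gen_erase s p' i hi, e, lin_cum, lin_cum, pi']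
          have := gen_nonneg (s.erase i) p (fun k hk => h0 k (mem_of_mem_erase hk))
                (fun k hk => h1 k (mem_of_mem_erase hk)) q
          nlinarith
        refine step.trans (ih p' ?_ ?_ ?_ ?_ ?_ ?_)
        · have : #{k ∈ s | p' k ≠ p0} < #{k ∈ s | p k ≠ p0} := by
            apply card_lt_card
            rw [ssubset_iff_of_subset]
            · exact ⟨i, by simp [hi, hilt.ne'], by simp [pi']⟩
            · intro k
              simp only [mem_filter]
              rintro ⟨hk, hk'⟩
              refine ⟨hk, ?_⟩
              by_cases hki : k = i
              · rw [hki]; exact hilt.ne'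
              rwa [pk' k hki] at hk'
          omega
        · exact dich (fun y => 0 ≤ y) hp0 h0
        · exact dich (fun y => y ≤ 1) hp1 h1
        · exact dich (fun y => y ≤ m) hp2 h2
        · exact dich (fun y => 1 - y ≤ m) hp3 h3
        · rw [← nsmul_eq_mul]
          exact card_nsmul_le_sum s p' p0 (dich (fun y => p0 ≤ y) le_rfl hlt)
      · push Not at hgt
        refine le_of_eq (congrArg (fun P => cum P q) (prod_congr rfl fun k hk => ?_))
        rw [le_antisymm (hgt k hk) (hlt k hk)]

open Polynomial in
lemma lin_pow_coeff (n : ℕ) (p : ℝ) (k : ℕ) (hk : k ≤ n) :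
    (lin p ^ n).coeff k = n.choose k * p ^ k * (1 - p) ^ (n - k) := by
  have h : lin p ^ n = ∑ j ∈ range (n + 1), C ((n.choose j) * p ^ j * (1 - p) ^ (n - j)) * X ^ j := by
    rw [lin, add_comm, add_pow]
    refine sum_congr rfl fun j _ => ?_
    rw [mul_pow]
    simp only [map_mul, map_pow, map_natCast]
    ring
  rw [h, finsetSum_coeff]
  simp only [coeff_C_mul_X_pow]
  rw [sum_ite_eq]
  simp [Nat.lt_succ_of_le hk]

open Polynomial in
lemma binom_tail (n : ℕ) (p : ℝ) (hp0 : 0 ≤ p) (hp1 : p ≤ 1) (q : ℕ) (hq : q ≤ n) :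
    cum (lin p ^ n) q * ((n + 1) * p - q) ≤ (lin p ^ n).coeff q * ((n - q + 1) * p) ∧
    cum (lin p ^ n) q * ((n + 1) * p - q - 1) ≤ (lin p ^ n).coeff q * ((n - q) * p) := by
  have hnn : ∀ k, 0 ≤ (lin p ^ n).coeff k := by
    intro k
    have := gen_nonneg (range n) (fun _ => p) (fun _ _ => hp0) (fun _ _ => hp1) k
    simpa [gen] using this
  have second : ∀ q : ℕ, cum (lin p ^ n) q * ((n + 1) * p - q) ≤ (lin p ^ n).coeff q * ((n - q + 1) * p)
      → cum (lin p ^ n) q * ((n + 1) * p - q - 1) ≤ (lin p ^ n).coeff q * ((n - q) * p) := by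
    intro q h
    have hS : (lin p ^ n).coeff q ≤ cum (lin p ^ n) q :=
      single_le_sum (f := fun k => (lin p ^ n).coeff k) (fun k _ => hnn k) (by simp)
    have := mul_nonneg (hnn q) (sub_nonneg.2 hp1)
    nlinarith
  induction q with
  | zero =>
    have : cum (lin p ^ n) 0 * ((n + 1) * p - (0 : ℕ)) ≤ (lin p ^ n).coeff 0 * ((n - (0 : ℕ) + 1) * p) := by
      simp [cum]
    exact ⟨this, second 0 this⟩
  | succ q ih =>
    have ih := (ih (by omega)).2
    have hrec : (lin p ^ n).coeff (q + 1) * ((q + 1) * (1 - p)) = (lin p ^ n).coeff q * ((n - q) * p) := by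
      rw [lin_pow_coeff n p _ hq, lin_pow_coeff n p q (by omega)]
      have c1 := Nat.choose_succ_right_eq n q
      have c2 : (n.choose (q + 1) : ℝ) * (q + 1) = n.choose q * (n - q) := by
        rw [← Nat.cast_sub (by omega : q ≤ n)]
        exact_mod_cast c1
      have e : n - q = (n - (q + 1)) + 1 := by omega
      rw [e, pow_succ, pow_succ]
      linear_combination (p ^ q * p * (1 - p) ^ (n - (q + 1)) * (1 - p)) * c2
    have hc : cum (lin p ^ n) (q + 1) = cum (lin p ^ n) q + (lin p ^ n).coeff (q + 1) := by
      rw [cum, sum_range_succ]; rfl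
    have := second (q + 1)
    have h1 : cum (lin p ^ n) (q + 1) * ((n + 1) * p - (q + 1 : ℕ))
        ≤ (lin p ^ n).coeff (q + 1) * ((n - (q + 1 : ℕ) + 1) * p) := by
      rw [hc]; push_cast; nlinarith
    exact ⟨h1, second _ h1⟩

lemma final_bound (n : ℕ) (β : ℝ) (q : ℕ) (r : ℝ) (hr : 0 ≤ r) (hβ0 : 0 ≤ β)
    (hβ : 0 < (n + 1) * (1 - β) - 2 * q - 2) :
    r ^ n * cum (lin ((1 - β) / 2) ^ n) q ≤ (n.choose (q + 1) : ℝ) * (r / 2) ^ n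
      * (1 + β) ^ (n - 1 - 2 * q) * (q + 1) / ((n + 1) * (1 - β) - 2 * q - 2) := by
  have hn : 2 * q + 2 ≤ n := by
    have : ((2 * q + 1 : ℕ) : ℝ) < n := by push_cast; nlinarith
    exact_mod_cast this
  have hb1 : 0 < 1 - β := by
    by_contra h
    push Not at h
    nlinarith
  obtain ⟨d, rfl⟩ := Nat.exists_eq_add_of_le hn
  have h := (binom_tail (2 * q + 2 + d) ((1 - β) / 2) (by linarith) (by linarith) q (by omega)).2
  rw [lin_pow_coeff _ _ q (by omega)] at h
  have c2 : ((2 * q + 2 + d).choose (q + 1) : ℝ) * (q + 1)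
      = (2 * q + 2 + d).choose q * (q + 2 + d) := by
    have c1 := Nat.choose_succ_right_eq (2 * q + 2 + d) q
    rw [show 2 * q + 2 + d - q = q + 2 + d by omega] at c1
    exact_mod_cast c1
  rw [le_div_iff₀ hβ, show 2 * q + 2 + d - 1 - 2 * q = d + 1 by omega]
  rw [show 2 * q + 2 + d - q = (q + 1) + (d + 1) by omega] at h
  push_cast at h hβ ⊢
  set S := cum (lin ((1 - β) / 2) ^ (2 * q + 2 + d)) q
  have hK : (((1 - β) / 2) * (1 - (1 - β) / 2)) ^ (q + 1) ≤ (1 / 4) ^ (q + 1) := by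
    apply pow_le_pow_left₀
    · apply mul_nonneg <;> linarith
    · nlinarith
  have e1 : ((1 - β) / 2) * (1 - (1 - β) / 2) = ((1 - β) / 2) * ((1 + β) / 2) := by ring
  have e2 : 1 - (1 - β) / 2 = (1 + β) / 2 := by ring
  rw [e1] at hK
  rw [e2] at h
  set Ch : ℝ := ((2 * q + 2 + d).choose q : ℝ)
  have hCh : 0 ≤ Ch := by positivity
  have h' : S * ((2 * q + 2 + d + 1) * (1 - β) - 2 * q - 2)
      ≤ 2 * Ch * (q + 2 + d) * ((1 + β) / 2) ^ (d + 1) *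
        (((1 - β) / 2) * ((1 + β) / 2)) ^ (q + 1) := by
    rw [mul_pow ((1 - β) / 2)]
    rw [pow_add ((1 + β) / 2)] at h
    rw [pow_succ ((1 - β) / 2) q]
    linarith
  have h'' : S * ((2 * q + 2 + d + 1) * (1 - β) - 2 * q - 2)
      ≤ 2 * Ch * (q + 2 + d) * ((1 + β) / 2) ^ (d + 1) * (1 / 4) ^ (q + 1) := by
    refine h'.trans (mul_le_mul_of_nonneg_left hK ?_)
    have : 0 ≤ (1 + β) / 2 := by linarith
    positivity
  have h3 := mul_le_mul_of_nonneg_left h'' (pow_nonneg hr (2 * q + 2 + d))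
  have e4 : (r / 2) ^ (2 * q + 2 + d) * (1 + β) ^ (d + 1)
      = r ^ (2 * q + 2 + d) * (2 * ((1 + β) / 2) ^ (d + 1) * (1 / 4) ^ (q + 1)) := by
    rw [div_pow, div_pow, div_pow, one_pow, show (4 : ℝ) = 2 ^ 2 by norm_num, ← pow_mul,
      show 2 * q + 2 + d = d + 2 * (q + 1) by ring, pow_add 2 d, pow_succ 2 d]
    field_simp
  calc _ = _ := mul_assoc _ _ _
    _ ≤ _ := h3
    _ = (Ch * (q + 2 + d)) * (r ^ (2 * q + 2 + d) * (2 * ((1 + β) / 2) ^ (d + 1) * (1 / 4) ^ (q + 1))) := by ring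
    _ = _ := by rw [← e4, ← c2]; ring

lemma outDeg_sum {c r : ℕ} (G : BalancedMPT c r) (y : Fin c × Fin r) :
    G.outDeg y = ∑ i ∈ univ.erase y.1, G.outDegIn y i := by
  have h : G.outDegIn y y.1 = 0 := by
    simp only [outDegIn, card_eq_zero, filter_eq_empty_iff]
    intro v _
    simp [G.samePart y (y.1, v) rfl]
  have := add_sum_erase univ (fun i => G.outDegIn y i) (mem_univ y.1)
  simp only [h, zero_add] at this
  rw [this]
  simp only [outDeg, outDegIn, card_filter, Fintype.sum_prod_type]

lemma inDeg_sum {c r : ℕ} (G : BalancedMPT c r) (y : Fin c × Fin r) :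
    G.inDeg y = ∑ i ∈ univ.erase y.1, G.inDegIn y i := by
  have h : G.inDegIn y y.1 = 0 := by
    simp only [inDegIn, card_eq_zero, filter_eq_empty_iff]
    intro v _
    simp [G.samePart (y.1, v) y rfl]
  have := add_sum_erase univ (fun i => G.inDegIn y i) (mem_univ y.1)
  simp only [h, zero_add] at this
  rw [this]
  simp only [inDeg, inDegIn, card_filter, Fintype.sum_prod_type]

lemma outIn_add {c r : ℕ} (G : BalancedMPT c r) (y : Fin c × Fin r) (i : Fin c) (hi : i ≠ y.1) :
    G.outDegIn y i + G.inDegIn y i = r := by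
  have : G.inDegIn y i = (univ.filter fun v : Fin r => ¬ G.adj y (i, v) = true).card := by
    unfold inDegIn
    congr 1
    ext v
    simp [G.oriented (i, v) y hi]
  rw [this, outDegIn, card_filter_add_card_filter_not]
  simp

lemma deg_add {c r : ℕ} (G : BalancedMPT c r) (y : Fin c × Fin r) :
    G.outDeg y + G.inDeg y = (c - 1) * r := by
  rw [outDeg_sum, inDeg_sum, ← sum_add_distrib,
    sum_congr rfl (fun i hi => outIn_add G y i (ne_of_mem_erase hi))]
  simp

open Polynomial in
lemma count_eq {c r : ℕ} (hr : 2 ≤ r) (G : BalancedMPT c r) (x : Fin c × Fin r) (q : ℕ) :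
    (((univ.filter fun f : Fin c → Fin r =>
          f x.1 = x.2 ∧ (univ.filter fun i => G.adj x (i, f i) = true).card ≤ q).card : ℕ) : ℝ)
      = (r : ℝ) ^ (c - 1) * cum (gen (univ.erase x.1) fun i => (G.outDegIn x i : ℝ) / r) q := by
  have hr0 : (r : ℝ) ≠ 0 := by
    have : r ≠ 0 := by omega
    exact_mod_cast this
  let t : Fin c → Finset (Fin r) := fun i => if i = x.1 then {x.2} else univ
  let P : ℝ[X] := ∏ i, ∑ v ∈ t i, X ^ (if G.adj x (i, v) = true then 1 else 0)
  have P1 : P = ∑ f ∈ Fintype.piFinset t, X ^ (univ.filter fun i => G.adj x (i, f i) = true).card := by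
    simp only [P]
    rw [Finset.prod_univ_sum]
    refine sum_congr rfl fun f _ => ?_
    rw [prod_pow_eq_pow_sum, card_filter]
  have P2 : P = C ((r : ℝ) ^ (c - 1)) * gen (univ.erase x.1) fun i => (G.outDegIn x i : ℝ) / r := by
    simp only [P]
    rw [← mul_prod_erase univ _ (mem_univ x.1)]
    have e1 : ∑ v ∈ t x.1, (X : ℝ[X]) ^ (if G.adj x (x.1, v) = true then 1 else 0) = 1 := by
      simp [t, G.samePart x (x.1, _) rfl]
    have e2 : C ((r : ℝ) ^ (c - 1)) = ∏ _i ∈ (univ : Finset (Fin c)).erase x.1, C (r : ℝ) := by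
      simp
    rw [e1, one_mul, e2, gen, ← prod_mul_distrib]
    refine prod_congr rfl fun i hi => ?_
    have hne := ne_of_mem_erase hi
    have hadd := outIn_add G x i hne
    have e3 : ∑ v ∈ t i, (X : ℝ[X]) ^ (if G.adj x (i, v) = true then 1 else 0)
        = C (G.outDegIn x i : ℝ) * X + C (G.inDegIn x i : ℝ) := by
      have hin : G.inDegIn x i = (univ.filter fun v : Fin r => ¬ G.adj x (i, v) = true).card := by
        unfold inDegIn
        congr 1
        ext v
        simp [G.oriented (i, v) x hne]
      simp only [t, if_neg hne]
      rw [← sum_filter_add_sum_filter_not univ (fun v => G.adj x (i, v) = true)]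
      congr 1
      · rw [sum_congr rfl (g := fun _ => X)]
        · simp [outDegIn]
        · intro v hv; simp [(mem_filter.1 hv).2]
      · rw [sum_congr rfl (g := fun _ => 1)]
        · rw [hin]; simp
        · intro v hv; simp [(mem_filter.1 hv).2]
    have e4 : (G.inDegIn x i : ℝ) = r * (1 - G.outDegIn x i / r) := by
      have : (G.outDegIn x i : ℝ) + G.inDegIn x i = r := by exact_mod_cast hadd
      field_simp; linarith
    have e5 : (G.outDegIn x i : ℝ) = r * (G.outDegIn x i / r) := by field_simp
    rw [e3, e4, lin, mul_add, ← C_mul, ← mul_assoc, ← C_mul, ← e5, add_comm]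
  have P3 : cum P q = (r : ℝ) ^ (c - 1) * cum (gen (univ.erase x.1) fun i => (G.outDegIn x i : ℝ) / r) q := by
    rw [P2, cum, cum, mul_sum]
    simp only [coeff_C_mul]
  rw [← P3, P1, cum]
  simp only [finsetSum_coeff, coeff_X_pow]
  rw [sum_comm]
  have : ∀ f : Fin c → Fin r, ∑ k ∈ range (q + 1),
      (if k = (univ.filter fun i => G.adj x (i, f i) = true).card then (1 : ℝ) else 0)
      = if (univ.filter fun i => G.adj x (i, f i) = true).card ≤ q then 1 else 0 := by
    intro f
    rw [sum_ite_eq']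
    simp
  simp only [this]
  rw [← sum_filter, sum_const, nsmul_eq_mul, mul_one]
  congr 2
  ext f
  simp only [mem_filter, mem_univ, true_and, Fintype.mem_piFinset, t]
  refine and_congr_left fun _ => ⟨fun h i => ?_, fun h => ?_⟩
  · by_cases hi : i = x.1
    · subst hi; simp [h]
    · simp [hi]
  · simpa using h x.1

/-- Theorem 4 of the paper: if `δ(G) ≥ q(r + μ(G))(c−1)/(c−2)` and `i_g(G) = r(c−1)β` with
`0 ≤ β < (c−2q−2)/c`, then for every vertex `x`,
`T⁺_q(x) ≤ C(c−1,q+1)(r/2)^{c−1}(1+β)^{c−2−2q}(q+1)/(c(1−β)−2q−2)`. -/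
theorem stmt19 (c r : ℕ) (hr : 2 ≤ r) (hc : 5 ≤ c) (G : BalancedMPT c r) (q : ℕ) (β : ℝ)
    (hβ0 : 0 ≤ β) (hβ : β < ((c : ℝ) - 2 * (q : ℝ) - 2) / (c : ℝ))
    (hδ : ((sInf (Set.range fun x : Fin c × Fin r => min (G.outDeg x) (G.inDeg x)) : ℕ) : ℝ)
      ≥ (q : ℝ) * ((r : ℝ) +
          (((univ : Finset (Fin c × Fin r)).sup fun x =>
            ((univ : Finset (Fin c)).erase x.1).sup fun i =>
              max (G.outDegIn x i - G.inDegIn x i) (G.inDegIn x i - G.outDegIn x i) : ℕ) : ℝ))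
        * (((c : ℝ) - 1) / ((c : ℝ) - 2)))
    (hig : ((((univ : Finset (Fin c × Fin r)).sup fun x => max (G.outDeg x) (G.inDeg x))
        - sInf (Set.range fun x : Fin c × Fin r => min (G.outDeg x) (G.inDeg x)) : ℕ) : ℝ)
      = (r : ℝ) * ((c : ℝ) - 1) * β) :
    ∀ x : Fin c × Fin r,
      (((univ.filter fun f : Fin c → Fin r =>
          f x.1 = x.2 ∧ (univ.filter fun i => G.adj x (i, f i) = true).card ≤ q).card : ℕ) : ℝ)
        ≤ (Nat.choose (c - 1) (q + 1) : ℝ) * ((r : ℝ) / 2) ^ (c - 1)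
            * (1 + β) ^ (c - 2 - 2 * q) * ((q : ℝ) + 1)
            / ((c : ℝ) * (1 - β) - 2 * (q : ℝ) - 2) := by
  intro x
  set δ := sInf (Set.range fun x : Fin c × Fin r => min (G.outDeg x) (G.inDeg x)) with hδdef
  set Δ := (univ : Finset (Fin c × Fin r)).sup fun x => max (G.outDeg x) (G.inDeg x) with hΔdef
  set μ := (univ : Finset (Fin c × Fin r)).sup fun x =>
            ((univ : Finset (Fin c)).erase x.1).sup fun i =>
              max (G.outDegIn x i - G.inDegIn x i) (G.inDegIn x i - G.outDegIn x i) with hμdef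
  obtain ⟨n, rfl⟩ : ∃ n, c = n + 1 := ⟨c - 1, by omega⟩
  have hmu : ∀ y : Fin (n + 1) × Fin r, ∀ i, i ≠ y.1 →
      2 * G.outDegIn y i ≤ r + μ ∧ 2 * G.inDegIn y i ≤ r + μ := by
    intro y i hi
    have h1 := outIn_add G y i hi
    have h2 : max (G.outDegIn y i - G.inDegIn y i) (G.inDegIn y i - G.outDegIn y i) ≤ μ :=
      (le_sup (f := fun i => max (G.outDegIn y i - G.inDegIn y i)
        (G.inDegIn y i - G.outDegIn y i)) (mem_erase.2 ⟨hi, mem_univ i⟩)).trans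
      (le_sup (f := fun x : Fin (n + 1) × Fin r =>
            ((univ : Finset (Fin (n + 1))).erase x.1).sup fun i =>
              max (G.outDegIn x i - G.inDegIn x i) (G.inDegIn x i - G.outDegIn x i)) (mem_univ y))
    omega
  have hdle : ∀ y, δ ≤ min (G.outDeg y) (G.inDeg y) := fun y => Nat.sInf_le ⟨y, rfl⟩
  obtain ⟨y, hy⟩ : δ ∈ Set.range fun x : Fin (n + 1) × Fin r => min (G.outDeg x) (G.inDeg x) :=
    Nat.sInf_mem ⟨_, x, rfl⟩
  have hDge : max (G.outDeg y) (G.inDeg y) ≤ Δ :=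
    le_sup (f := fun x => max (G.outDeg x) (G.inDeg x)) (mem_univ y)
  have hDle : Δ ≤ n * r - δ := by
    refine Finset.sup_le fun z _ => ?_
    have := deg_add G z
    have := hdle z
    simp only [Nat.add_sub_cancel] at *
    omega
  have hDd : Δ + δ = n * r ∧ δ ≤ Δ := by
    have := deg_add G y
    simp only [Nat.add_sub_cancel] at *
    omega
  have hr0 : (0 : ℝ) < r := by
    have : 0 < r := by omega
    exact_mod_cast this
  have hn4 : (4 : ℝ) ≤ n := by
    have : 4 ≤ n := by omega
    exact_mod_cast this
  have hδval : (δ : ℝ) = n * r * ((1 - β) / 2) := by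
    rw [Nat.cast_sub hDd.2] at hig
    have : (Δ : ℝ) + δ = n * r := by exact_mod_cast hDd.1
    push_cast at hig
    linarith
  have hβ' : 0 < ((n : ℝ) + 1) * (1 - β) - 2 * q - 2 := by
    rw [lt_div_iff₀ (by positivity)] at hβ
    push_cast at hβ
    linarith
  have hb1 : 0 < 1 - β := by
    by_contra h
    push Not at h
    have : (0 : ℝ) ≤ q := by positivity
    nlinarith
  have hcard : #((univ : Finset (Fin (n + 1))).erase x.1) = n := by simp
  have hfac : ∀ i ∈ (univ : Finset (Fin (n + 1))).erase x.1,
      (G.outDegIn x i : ℝ) + G.inDegIn x i = r ∧ 2 * (G.outDegIn x i : ℝ) ≤ r + μ ∧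
        2 * (G.inDegIn x i : ℝ) ≤ r + μ := by
    intro i hi
    have h1 := outIn_add G x i (ne_of_mem_erase hi)
    have h2 := hmu x i (ne_of_mem_erase hi)
    exact ⟨by exact_mod_cast h1, by exact_mod_cast h2.1, by exact_mod_cast h2.2⟩
  have hΔμ : 2 * (Δ : ℝ) ≤ n * (r + μ) := by
    have : Δ * 2 ≤ n * (r + μ) := by
      rw [← Nat.le_div_iff_mul_le (by norm_num)]
      refine Finset.sup_le fun z _ => ?_
      rw [Nat.le_div_iff_mul_le (by norm_num), mul_comm]
      have o : 2 * G.outDeg z ≤ n * (r + μ) := by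
        rw [outDeg_sum, mul_sum]
        refine (sum_le_card_nsmul _ _ (r + μ) fun i hi => (hmu z i (ne_of_mem_erase hi)).1).trans ?_
        simp
      have o' : 2 * G.inDeg z ≤ n * (r + μ) := by
        rw [inDeg_sum, mul_sum]
        refine (sum_le_card_nsmul _ _ (r + μ) fun i hi => (hmu z i (ne_of_mem_erase hi)).2).trans ?_
        simp
      rcases max_choice (G.outDeg z) (G.inDeg z) with h | h <;> rw [h] <;> assumption
    have : (Δ : ℝ) * 2 ≤ n * (r + μ) := by exact_mod_cast this
    linarith
  have hΔval : (Δ : ℝ) = n * r * ((1 + β) / 2) := by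
    have : (Δ : ℝ) + δ = n * r := by exact_mod_cast hDd.1
    linarith
  have hm3 : r * (1 + β) ≤ r + μ := by
    have : (n : ℝ) * (r * (1 + β)) ≤ n * (r + μ) := by linarith
    exact le_of_mul_le_mul_left this (by linarith)
  rw [count_eq hr, Nat.add_sub_cancel]
  have hsm : cum (gen (univ.erase x.1) fun i => (G.outDegIn x i : ℝ) / r) q
      ≤ cum (gen ((univ : Finset (Fin (n + 1))).erase x.1) fun _ => (1 - β) / 2) q := by
    have hμ0 : (0 : ℝ) ≤ μ := by positivity
    refine smoothing _ ((r + μ) / (2 * r)) ((1 - β) / 2) q (by positivity) (by linarith)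
      (by linarith) ?_ ?_ ?_ _ _ le_rfl ?_ ?_ ?_ ?_ ?_
    · rw [le_div_iff₀ (by positivity)]; nlinarith
    · rw [le_div_iff₀ (by positivity)]; nlinarith
    · rw [hcard]
      rw [hδval] at hδ
      push_cast at hδ
      have hn1 : (0 : ℝ) < n - 1 := by linarith
      rw [show (n : ℝ) + 1 - 1 = n by ring, show (n : ℝ) + 1 - 2 = n - 1 by ring] at hδ
      have h5 : n * (q * ((r : ℝ) + μ)) ≤ n * (r * ((n - 1) * ((1 - β) / 2))) := by
        have := mul_le_mul_of_nonneg_right hδ.le hn1.le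
        rw [mul_assoc _ ((n : ℝ) / (n - 1)), div_mul_cancel₀ _ hn1.ne'] at this
        linarith
      have h6 := le_of_mul_le_mul_left h5 (by linarith)
      rw [show 2 * (q : ℝ) * ((r + μ) / (2 * r)) = q * (r + μ) / r by field_simp,
        div_le_iff₀ hr0]
      linarith
    · intro i hi; positivity
    · intro i hi
      rw [div_le_one hr0]
      have := (hfac i hi).1
      have : (0 : ℝ) ≤ G.inDegIn x i := by positivity
      linarith
    · intro i hi
      have := (hfac i hi).2.1
      rw [div_le_div_iff₀ hr0 (by positivity)]
      nlinarith
    · intro i hi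
      have h1 := (hfac i hi).1
      have := (hfac i hi).2.2
      have e : 1 - (G.outDegIn x i : ℝ) / r = G.inDegIn x i / r := by
        field_simp; linarith
      rw [e, div_le_div_iff₀ hr0 (by positivity)]
      nlinarith
    · rw [hcard, ← sum_div, le_div_iff₀ hr0]
      have h1 : δ ≤ G.outDeg x := (hdle x).trans (min_le_left _ _)
      rw [outDeg_sum] at h1
      have h2 : (δ : ℝ) ≤ ∑ i ∈ univ.erase x.1, (G.outDegIn x i : ℝ) := by exact_mod_cast h1
      linarith
  have hg : gen ((univ : Finset (Fin (n + 1))).erase x.1) (fun _ => (1 - β) / 2)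
      = lin ((1 - β) / 2) ^ n := by
    rw [gen, prod_const, hcard]
  rw [hg] at hsm
  have hf := final_bound n β q r hr0.le hβ0 hβ'
  refine (mul_le_mul_of_nonneg_left hsm (pow_nonneg hr0.le n)).trans ?_
  rw [show n + 1 - 2 - 2 * q = n - 1 - 2 * q by omega]
  push_cast
  exact hf
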